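/- arXiv:1912.07302 — 3 statements merged into one kernel-verified Lean document; each statement's English description precedes it below -/
import Mathlib

section
/- Let n ≥ 10, let m = ⌈n/2⌉ − 1, and let G = Circ[n, {1,2,...,m} \ {m−1}]. Then κ(G) = δ(G) = ξ(G) = M(G) = Z(G) = 2(m−1). -/
open scoped Classical

noncomputable section

namespace Paper

variable {V : Type*}

/-- The set of vertices eventually colored blue starting from `Z` under the
zero forcing color change rule. -/
inductive Forced (G : SimpleGraph V) (Z : Set V) : V → Prop
  | init (v : V) : v ∈ Z → Forced G Z v
  | force (u w : V) : Forced G Z u → G.Adj u w →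
      (∀ x, G.Adj u x → x ≠ w → Forced G Z x) → Forced G Z w

/-- `Z` is a zero forcing set of `G`. -/
def IsZeroForcingSet (G : SimpleGraph V) (Z : Set V) : Prop := ∀ v, Forced G Z v

/-- The zero forcing number `Z(G)`. -/
def zfn (G : SimpleGraph V) : ℕ :=
  sInf {m | ∃ Z : Set V, Z.ncard = m ∧ IsZeroForcingSet G Z}

/-- Membership in the set `S(F,G)` of symmetric matrices described by `G`. -/
def SMat (F : Type*) [Field F] (G : SimpleGraph V) (A : Matrix V V F) : Prop :=
  A.IsSymm ∧ ∀ i j : V, i ≠ j → (A i j ≠ 0 ↔ G.Adj i j)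

/-- Maximum nullity `M(F,G)`. -/
def maxNullity (F : Type*) [Field F] [Fintype V] (G : SimpleGraph V) : ℕ :=
  sSup {m | ∃ A : Matrix V V F, SMat F G A ∧ Fintype.card V - A.rank = m}

/-- Minimum rank `mr(F,G)`. -/
def minRank (F : Type*) [Field F] [Fintype V] (G : SimpleGraph V) : ℕ :=
  sInf {m | ∃ A : Matrix V V F, SMat F G A ∧ A.rank = m}

/-- The Strong Arnold Property. -/
def HasSAP [Fintype V] [DecidableEq V] (A : Matrix V V ℝ) : Prop :=
  ∀ X : Matrix V V ℝ, X.IsSymm → A * X = 0 → Matrix.hadamard A X = 0 →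
    Matrix.hadamard (1 : Matrix V V ℝ) X = 0 → X = 0

/-- The Colin de Verdière type parameter `ξ(G)`. -/
def xi [Fintype V] [DecidableEq V] (G : SimpleGraph V) : ℕ :=
  sSup {m | ∃ A : Matrix V V ℝ, SMat ℝ G A ∧ HasSAP A ∧ Fintype.card V - A.rank = m}

/-- The adjacency matrix of `G` with entries in `R`. -/
def adjMat (R : Type*) [Zero R] [One R] (G : SimpleGraph V) : Matrix V V R :=
  Matrix.of fun i j => if G.Adj i j then 1 else 0

/-- Minimum degree `δ(G)`. -/
def minDeg (G : SimpleGraph V) : ℕ :=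
  sInf {d | ∃ v : V, (G.neighborSet v).ncard = d}

/-- Vertex connectivity `κ(G)`. -/
def vertexConnectivity [Fintype V] (G : SimpleGraph V) : ℕ :=
  if G = (⊤ : SimpleGraph V) then Fintype.card V - 1
  else sInf {m | ∃ S : Set V, S.ncard = m ∧ ¬ (G.induce Sᶜ).Connected}

/-- The circulant graph `Circ[n,S]`. -/
def circG (n : ℕ) (S : Set ℕ) : SimpleGraph (ZMod n) :=
  SimpleGraph.fromRel (fun i j => ∃ s ∈ S, j = i + (s : ZMod n))


/-- A kernel vector of a matrix in `S(F,G)` vanishing on `Z` vanishes on all forced vertices. -/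
lemma Forced.eq_zero_of_mulVec_eq_zero [Fintype V] {F : Type*} [Field F] {G : SimpleGraph V}
    {A : Matrix V V F} (hA : SMat F G A) {Z : Set V} {x : V → F} (hx : A.mulVec x = 0)
    (hZ : ∀ v ∈ Z, x v = 0) {v : V} (hv : Forced G Z v) : x v = 0 := by
  induction hv with
  | init v h => exact hZ v h
  | force u w _ huw _ hu ih =>
    have h := congrFun hx u
    rw [Matrix.mulVec, dotProduct, Finset.sum_eq_single w] at h
    · exact (mul_eq_zero.1 h).resolve_left ((hA.2 u w huw.ne).2 huw)
    · intro b _ hb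
      by_cases hub : u = b
      · rw [← hub, hu, mul_zero]
      · by_cases hadj : G.Adj u b
        · rw [ih b hadj hb, mul_zero]
        · have : A u b = 0 := by
            by_contra hne
            exact hadj ((hA.2 u b hub).1 hne)
          rw [this, zero_mul]
    · simp

/-- The nullity of a matrix in `S(F,G)` is at most the size of any zero forcing set. -/
lemma card_sub_rank_le_ncard [Fintype V] {F : Type*} [Field F] {G : SimpleGraph V}
    {A : Matrix V V F} (hA : SMat F G A) {Z : Set V} (hZ : IsZeroForcingSet G Z) :
    Fintype.card V - A.rank ≤ Z.ncard := by
  have hrn := A.mulVecLin.finrank_range_add_finrank_ker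
  rw [Module.finrank_fintype_fun_eq_card] at hrn
  let f : LinearMap.ker A.mulVecLin →ₗ[F] (Z → F) :=
    (LinearMap.funLeft F F (Subtype.val : Z → V)).comp (Submodule.subtype _)
  have hf : Function.Injective f := by
    rw [← LinearMap.ker_eq_bot, LinearMap.ker_eq_bot']
    rintro ⟨x, hx⟩ h
    ext v
    refine Forced.eq_zero_of_mulVec_eq_zero hA (by simpa using hx) (fun w hw => ?_) (hZ v)
    exact congrFun h ⟨w, hw⟩
  have h := LinearMap.finrank_le_finrank_of_injective hf
  rw [Module.finrank_fintype_fun_eq_card, ← Nat.card_eq_fintype_card, Nat.card_coe_set_eq] at h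
  have : A.rank = Module.finrank F (LinearMap.range A.mulVecLin) := rfl
  omega

/-- A matrix with the Strong Arnold Property and a zero forcing set of the same size as its
nullity determine `ξ`, `M` and `Z`. -/
lemma xi_maxNullity_zfn_eq [Fintype V] [DecidableEq V] {G : SimpleGraph V} {d : ℕ}
    {A : Matrix V V ℝ} (hA : SMat ℝ G A) (hsap : HasSAP A) (hd : d ≤ Fintype.card V - A.rank)
    {Z : Set V} (hZ : IsZeroForcingSet G Z) (hZd : Z.ncard = d) :
    xi G = d ∧ maxNullity ℝ G = d ∧ zfn G = d := by
  have hAd : Fintype.card V - A.rank = d :=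
    le_antisymm (hZd ▸ card_sub_rank_le_ncard hA hZ) hd
  refine ⟨IsGreatest.csSup_eq ⟨⟨A, hA, hsap, hAd⟩, ?_⟩,
    IsGreatest.csSup_eq ⟨⟨A, hA, hAd⟩, ?_⟩, IsLeast.csInf_eq ⟨⟨Z, hZd, hZ⟩, ?_⟩⟩
  · rintro _ ⟨B, hB, -, rfl⟩
    exact hZd ▸ card_sub_rank_le_ncard hB hZ
  · rintro _ ⟨B, hB, rfl⟩
    exact hZd ▸ card_sub_rank_le_ncard hB hZ
  · rintro _ ⟨Y, rfl, hY⟩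
    exact hAd ▸ card_sub_rank_le_ncard hA hY

/-- If every vertex has at most `k ≤ 3` non-neighbors, and distinct vertices have at most `k - 1`
common non-neighbors, then every induced subgraph on at least `k + 2` vertices is connected. -/
lemma induce_connected [Finite V] {G : SimpleGraph V} {k : ℕ} (hk : k ≤ 3)
    (h₁ : ∀ v, {w | w ≠ v ∧ ¬ G.Adj v w}.ncard ≤ k)
    (h₂ : ∀ u v, u ≠ v →
      {w | (w ≠ u ∧ ¬ G.Adj u w) ∧ w ≠ v ∧ ¬ G.Adj v w}.ncard ≤ k - 1)
    {U : Set V} (hU : k + 2 ≤ U.ncard) : (G.induce U).Connected := by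
  have hne : U.Nonempty := by
    rw [← Set.ncard_pos]; omega
  have : Nonempty U := hne.to_subtype
  refine ⟨fun u v => ?_⟩
  by_contra huv
  set C : Set V := {x | ∃ hx : x ∈ U, (G.induce U).Reachable u ⟨x, hx⟩} with hC
  set D : Set V := U \ C with hD
  have hCU : C ⊆ U := fun x hx => hx.1
  have hcard : D.ncard + C.ncard = U.ncard := Set.ncard_sdiff_add_ncard_of_subset hCU
  have huC : (u : V) ∈ C := ⟨u.2, SimpleGraph.Reachable.refl _⟩
  have hvD : (v : V) ∈ D := ⟨v.2, fun h => huv h.2⟩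
  have hCD : ∀ c ∈ C, ∀ d ∈ D, c ≠ d ∧ ¬ G.Adj c d := by
    rintro c hc d hd
    refine ⟨fun h => hd.2 (h ▸ hc), fun h => hd.2 ⟨hd.1, hc.2.trans ?_⟩⟩
    exact SimpleGraph.Adj.reachable (G := G.induce U) (u := ⟨c, hc.1⟩) (v := ⟨d, hd.1⟩) h
  have hCk : C.ncard ≤ k := (h₁ v).trans' (Set.ncard_le_ncard fun c hc =>
    ⟨(hCD c hc v hvD).1, fun h => (hCD c hc v hvD).2 h.symm⟩)
  have hDk : D.ncard ≤ k := (h₁ u).trans' (Set.ncard_le_ncard fun d hd =>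
    ⟨(hCD u huC d hd).1.symm, (hCD u huC d hd).2⟩)
  obtain ⟨a, ha, b, hb, hab⟩ := (Set.one_lt_ncard (s := C)).1 (by omega)
  obtain ⟨a', ha', b', hb', hab'⟩ := (Set.one_lt_ncard (s := D)).1 (by omega)
  have hDk' : D.ncard ≤ k - 1 := (h₂ a b hab).trans' (Set.ncard_le_ncard fun d hd =>
    ⟨⟨(hCD a ha d hd).1.symm, (hCD a ha d hd).2⟩, (hCD b hb d hd).1.symm, (hCD b hb d hd).2⟩)
  have hCk' : C.ncard ≤ k - 1 := (h₂ a' b' hab').trans' (Set.ncard_le_ncard fun c hc =>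
    ⟨⟨(hCD c hc a' ha').1, fun h => (hCD c hc a' ha').2 h.symm⟩,
      (hCD c hc b' hb').1, fun h => (hCD c hc b' hb').2 h.symm⟩)
  omega

section Cayley

variable {n : ℕ} {G : SimpleGraph (ZMod n)} {T : Finset (ZMod n)}

lemma forced_of_forall_notMem (hG : ∀ i j, G.Adj i j ↔ i ≠ j ∧ j - i ∉ T)
    (hneg : ∀ t ∈ T, -t ∈ T)
    (hpeel : ∀ T' ⊆ T, T'.Nonempty → ∃ e, e ∉ T' ∧ ∃ t₀ ∈ T', e - t₀ ∉ T ∧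
      ∀ t ∈ T', t ≠ t₀ → e - t ∈ T) {Z : Set (ZMod n)} :
    ∀ T' ⊆ T, (∀ v ∉ T', Forced G Z v) → IsZeroForcingSet G Z := by
  intro T'
  induction T' using Finset.strongInduction with
  | H T' ih =>
    intro hsub hT'
    rcases T'.eq_empty_or_nonempty with rfl | hne
    · exact fun v => hT' v (by simp)
    obtain ⟨e, he, t₀, ht₀, hadj, hother⟩ := hpeel T' hsub hne
    refine ih (T'.erase t₀) (Finset.erase_ssubset ht₀) ((Finset.erase_subset _ _).trans hsub) ?_
    intro v hv
    by_cases hvt : v = t₀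
    · subst hvt
      refine Forced.force e v (hT' e he)
        ((hG _ _).2 ⟨fun h => he (h ▸ ht₀), fun h => hadj (by simpa using hneg _ h)⟩) ?_
      intro x hx hxv
      refine hT' x fun hxT => ((hG _ _).1 hx).2 ?_
      simpa using hneg _ (hother x hxT hxv)
    · exact hT' v fun h => hv (Finset.mem_erase.2 ⟨hvt, h⟩)

variable [NeZero n]

lemma ncard_neighborSet (hG : ∀ i j, G.Adj i j ↔ i ≠ j ∧ j - i ∉ T) (h0 : 0 ∉ T) (v : ZMod n) :
    (G.neighborSet v).ncard = n - (T.card + 1) := by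
  have : G.neighborSet v = (((insert 0 T).map (addLeftEmbedding v) : Finset (ZMod n)) :
      Set (ZMod n))ᶜ := by
    ext w
    simp only [SimpleGraph.mem_neighborSet, hG, Set.mem_compl_iff, Finset.mem_coe,
      Finset.mem_map, addLeftEmbedding_apply, Finset.mem_insert]
    constructor
    · rintro ⟨h1, h2⟩ ⟨t, rfl | ht, rfl⟩
      · simp at h1
      · simp [ht] at h2
    · intro h
      exact ⟨fun hvw => h ⟨0, Or.inl rfl, by simp [hvw]⟩,
        fun ht => h ⟨_, Or.inr ht, by ring⟩⟩
  rw [this, Set.ncard_compl, Set.ncard_coe_finset, Finset.card_map,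
    Finset.card_insert_of_notMem h0, Nat.card_zmod]

lemma minDeg_eq (hG : ∀ i j, G.Adj i j ↔ i ≠ j ∧ j - i ∉ T) (h0 : 0 ∉ T) :
    minDeg G = n - (T.card + 1) := by
  refine IsLeast.csInf_eq ⟨⟨0, ncard_neighborSet hG h0 0⟩, ?_⟩
  rintro _ ⟨v, rfl⟩
  exact (ncard_neighborSet hG h0 v).ge

lemma vertexConnectivity_eq (hG : ∀ i j, G.Adj i j ↔ i ≠ j ∧ j - i ∉ T) (h0 : 0 ∉ T)
    (hT : T.Nonempty) (hT3 : T.card ≤ 3) (hstab : ∀ d, d ≠ 0 → ∃ t ∈ T, t + d ∉ T) :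
    vertexConnectivity G = n - (T.card + 1) := by
  obtain ⟨t, ht⟩ := hT
  have ht0 : t ≠ 0 := fun h => h0 (h ▸ ht)
  have hnadj : ¬ G.Adj 0 t := by simp [hG, ht]
  have hnn : ∀ v w, (w ≠ v ∧ ¬ G.Adj v w) ↔ w - v ∈ T := by
    intro v w
    rw [hG]
    constructor
    · rintro ⟨h1, h2⟩
      by_contra h
      exact h2 ⟨h1.symm, h⟩
    · intro h
      exact ⟨fun hvw => h0 (by simpa [hvw] using h), fun h' => h'.2 h⟩
  have himg : ∀ v, {w | w - v ∈ T} = ((T.map (addLeftEmbedding v) : Finset (ZMod n)) :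
      Set (ZMod n)) := by
    intro v
    ext w
    simp only [Set.mem_ofPred_eq, Finset.mem_coe, Finset.mem_map, addLeftEmbedding_apply]
    exact ⟨fun h => ⟨_, h, by ring⟩, by rintro ⟨s, hs, rfl⟩; simpa using hs⟩
  have hcardT : ∀ v, {w | w - v ∈ T}.ncard = T.card := by
    intro v
    rw [himg, Set.ncard_coe_finset, Finset.card_map]
  rw [vertexConnectivity, if_neg (fun h => hnadj (by rw [h]; exact ht0.symm))]
  refine IsLeast.csInf_eq ⟨⟨G.neighborSet 0, ncard_neighborSet hG h0 0, fun hc => ?_⟩, ?_⟩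
  · have hpre := hc.preconnected ⟨0, by simp⟩ ⟨t, by simpa using hnadj⟩
    obtain ⟨p⟩ := hpre
    cases p with
    | nil => exact ht0 rfl
    | cons h p => rename_i w; exact w.2 h
  · rintro _ ⟨S, rfl, hS⟩
    by_contra hlt
    refine hS (induce_connected hT3 (fun v => ?_) (fun u v huv => ?_) ?_)
    · simp only [hnn, hcardT, le_refl]
    · simp only [hnn]
      have hss : {w | w - u ∈ T ∧ w - v ∈ T} ⊂ {w | w - u ∈ T} := by
        refine ⟨fun w hw => hw.1, fun hsub => ?_⟩
        obtain ⟨s, hs, hsd⟩ := hstab (u - v) (sub_ne_zero.2 huv)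
        refine hsd ?_
        have := (hsub (show u + s ∈ {w | w - u ∈ T} by simpa using hs)).2
        rwa [show s + (u - v) = u + s - v by ring]
      have := Set.ncard_lt_ncard hss
      rw [hcardT] at this
      omega
    · rw [Set.ncard_compl, Nat.card_zmod]
      omega

lemma exists_isZeroForcingSet (hG : ∀ i j, G.Adj i j ↔ i ≠ j ∧ j - i ∉ T) (h0 : 0 ∉ T)
    (hcard : T.card + 1 < n) (hneg : ∀ t ∈ T, -t ∈ T)
    (hpeel : ∀ T' ⊆ T, T'.Nonempty → ∃ e, e ∉ T' ∧ ∃ t₀ ∈ T', e - t₀ ∉ T ∧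
      ∀ t ∈ T', t ≠ t₀ → e - t ∈ T) :
    ∃ Z : Set (ZMod n), IsZeroForcingSet G Z ∧ Z.ncard = n - (T.card + 1) := by
  obtain ⟨w, hw⟩ : ∃ w, w ∉ insert 0 T := by
    by_contra! h
    have := Finset.card_le_card (fun x _ => h x : (Finset.univ : Finset (ZMod n)) ⊆ insert 0 T)
    rw [Finset.card_insert_of_notMem h0, Finset.card_univ, ZMod.card] at this
    omega
  rw [Finset.mem_insert, not_or] at hw
  refine ⟨((insert w T : Finset (ZMod n)) : Set (ZMod n))ᶜ,
    forced_of_forall_notMem hG hneg hpeel T subset_rfl ?_, ?_⟩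
  · intro v hv
    by_cases hvw : v = w
    · subst hvw
      refine Forced.force 0 v (Forced.init _ ?_) ((hG _ _).2 ⟨hw.1 ∘ Eq.symm, by simpa using hv⟩) ?_
      · simp [h0, Ne.symm hw.1]
      · intro x hx hxv
        have := ((hG _ _).1 hx).2
        rw [sub_zero] at this
        exact Forced.init _ (by simp [this, hxv])
    · exact Forced.init _ (by simp [hv, hvw])
  · rw [Set.ncard_compl, Set.ncard_coe_finset, Finset.card_insert_of_notMem hw.2, Nat.card_zmod]

lemma hasSAP_of_peel {A : Matrix (ZMod n) (ZMod n) ℝ} (hA : ∀ i j, A i j = 0 ↔ i - j ∈ T)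
    (hpeel : ∀ T' ⊆ T, T'.Nonempty → ∃ e, ∃ t₀ ∈ T', e - t₀ ∉ T ∧
      ∀ t ∈ T', t ≠ t₀ → e - t ∈ T) : HasSAP A := by
  intro X _ hAX hX _
  ext i j
  by_contra hij
  have hsupp : ∀ i j, X i j ≠ 0 → i - j ∈ T := by
    intro i j h
    have := congrFun (congrFun hX i) j
    rw [Matrix.hadamard_apply] at this
    exact (hA i j).1 ((mul_eq_zero.1 this).resolve_right h)
  obtain ⟨e, t₀, ht₀, he, hother⟩ := hpeel (T.filter fun t => X (j + t) j ≠ 0)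
    (Finset.filter_subset _ _)
    ⟨i - j, Finset.mem_filter.2 ⟨hsupp i j hij, by simpa using hij⟩⟩
  have h := congrFun (congrFun hAX (j + e)) j
  rw [Matrix.mul_apply, Finset.sum_eq_single (j + t₀)] at h
  · refine (mul_ne_zero (fun h' => he ?_) (Finset.mem_filter.1 ht₀).2) h
    simpa using (hA _ _).1 h'
  · intro b _ hb
    by_cases hXb : X b j = 0
    · rw [hXb, mul_zero]
    · have := hother (b - j) (Finset.mem_filter.2 ⟨hsupp b j hXb, by simpa using hXb⟩)
        (fun h => hb (by rw [← h]; ring))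
      rw [(hA _ _).2 (by rwa [show j + e - b = e - (b - j) by ring]), zero_mul]
  · simp

lemma parameters_eq (hG : ∀ i j, G.Adj i j ↔ i ≠ j ∧ j - i ∉ T) (h0 : 0 ∉ T)
    (hT : T.Nonempty) (hT3 : T.card ≤ 3) (hcard : T.card + 1 < n) (hneg : ∀ t ∈ T, -t ∈ T)
    (hstab : ∀ d, d ≠ 0 → ∃ t ∈ T, t + d ∉ T)
    (hpeel : ∀ T' ⊆ T, T'.Nonempty → ∃ e, e ∉ T' ∧ ∃ t₀ ∈ T', e - t₀ ∉ T ∧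
      ∀ t ∈ T', t ≠ t₀ → e - t ∈ T)
    {A : Matrix (ZMod n) (ZMod n) ℝ} (hA : ∀ i j, A i j = 0 ↔ i - j ∈ T) (hsymm : A.IsSymm)
    (hrank : A.rank ≤ T.card + 1) :
    vertexConnectivity G = n - (T.card + 1) ∧ minDeg G = n - (T.card + 1) ∧
      xi G = n - (T.card + 1) ∧ maxNullity ℝ G = n - (T.card + 1) ∧
      zfn G = n - (T.card + 1) := by
  obtain ⟨Z, hZ, hZc⟩ := exists_isZeroForcingSet hG h0 hcard hneg hpeel
  refine ⟨vertexConnectivity_eq hG h0 hT hT3 hstab, minDeg_eq hG h0,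
    xi_maxNullity_zfn_eq (A := A) ⟨hsymm, fun i j hij => ?_⟩
      (hasSAP_of_peel hA fun T' h1 h2 => ?_) ?_ hZ hZc⟩
  · have : i - j ∈ T ↔ j - i ∈ T :=
      ⟨fun h => by simpa using hneg _ h, fun h => by simpa using hneg _ h⟩
    rw [hG, ne_eq, hA, this]
    exact ⟨fun h => ⟨hij, h⟩, fun h => h.2⟩
  · obtain ⟨e, -, h⟩ := hpeel T' h1 h2
    exact ⟨e, h⟩
  · rw [ZMod.card]
    omega

end Cayley

section Circulant

variable {n : ℕ}

lemma intCast_eq_zero_cases {a : ℤ} (h : (a : ZMod n) = 0) (h₁ : -3 * n < a) (h₂ : a < 3 * n) :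
    a = 0 ∨ a = n ∨ a = -n ∨ a = 2 * n ∨ a = -2 * n := by
  obtain ⟨k, rfl⟩ := (ZMod.intCast_zmod_eq_zero_iff_dvd a n).1 h
  have hk₁ : -3 < k := by nlinarith
  have hk₂ : k < 3 := by nlinarith
  interval_cases k <;> omega

lemma circG_adj {S : Set ℕ} {i j : ZMod n} : (circG n S).Adj i j ↔
    i ≠ j ∧ ∃ s ∈ S, j - i = ((s : ℤ) : ZMod n) ∨ j - i = ((-s : ℤ) : ZMod n) := by
  rw [circG, SimpleGraph.fromRel_adj]
  refine and_congr_right fun _ => ⟨?_, ?_⟩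
  · rintro (⟨s, hs, rfl⟩ | ⟨s, hs, rfl⟩)
    · exact ⟨s, hs, Or.inl (by simp)⟩
    · exact ⟨s, hs, Or.inr (by simp)⟩
  · rintro ⟨s, hs, h | h⟩ <;> push_cast at h
    · exact Or.inl ⟨s, hs, by linear_combination h⟩
    · exact Or.inr ⟨s, hs, by linear_combination -h⟩

variable [NeZero n]

lemma sin_pi_mul_div_eq_zero_iff (a : ℤ) :
    Real.sin (Real.pi * a / n) = 0 ↔ (a : ZMod n) = 0 := by
  have hn : (n : ℝ) ≠ 0 := NeZero.ne _
  rw [ZMod.intCast_zmod_eq_zero_iff_dvd, Real.sin_eq_zero_iff]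
  refine exists_congr fun k => ⟨fun h => ?_, fun h => ?_⟩
  · rw [eq_div_iff hn] at h
    have : (a : ℝ) = n * k := mul_left_cancel₀ Real.pi_ne_zero (by linear_combination -h)
    exact_mod_cast this
  · rw [h]
    push_cast
    field_simp

lemma intCast_val_sub_val_add (i j : ZMod n) (c : ℤ) :
    (((i.val : ℤ) - j.val + c : ℤ) : ZMod n) = i - j + c := by
  push_cast
  rw [ZMod.natCast_zmod_val, ZMod.natCast_zmod_val]

lemma rank_le_of_eq_sum {k : ℕ} {A : Matrix V V ℝ} [Fintype V] (f g : Fin k → V → ℝ)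
    (h : ∀ i j, A i j = ∑ l, f l i * g l j) : A.rank ≤ k := by
  have : A = (Matrix.of fun i l => f l i) * (Matrix.of g) := by
    ext i j
    rw [h, Matrix.mul_apply]
    rfl
  rw [this]
  refine (Matrix.rank_mul_le_left _ _).trans ?_
  simpa using Matrix.rank_le_card_width (Matrix.of fun i l => f l i)

/-- A symmetric matrix of rank at most three vanishing exactly when `i - j = ±s`. -/
lemma exists_rank_le_three (s : ℤ) : ∃ A : Matrix (ZMod n) (ZMod n) ℝ,
    (∀ i j, A i j = 0 ↔ i - j ∈ ({(s : ZMod n), -(s : ZMod n)} : Finset (ZMod n))) ∧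
      A.IsSymm ∧ A.rank ≤ 3 := by
  have hA : ∀ x a : ℝ, Real.sin (x + a) * Real.sin (x + -a) =
      Real.cos (2 * a) / 2 - Real.cos (2 * x) / 2 := by
    intro x a
    have := Real.cos_sub_cos (2 * a) (2 * x)
    rw [show (2 * a + 2 * x) / 2 = x + a by ring,
      show (2 * a - 2 * x) / 2 = -(x + -a) by ring, Real.sin_neg] at this
    linear_combination -this / 2
  set θ : ZMod n → ℝ := fun i => Real.pi * i.val / n with hθ
  have harg : ∀ (i j : ZMod n) (c : ℤ), θ i - θ j + Real.pi * c / n =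
      Real.pi * ((i.val - j.val + c : ℤ) : ℝ) / n := by
    intro i j c
    simp only [hθ]
    push_cast
    ring
  have harg' : ∀ (i j : ZMod n) (c : ℤ), Real.sin (θ i - θ j + Real.pi * c / n) = 0 ↔
      i - j + c = 0 := by
    intro i j c
    rw [harg, sin_pi_mul_div_eq_zero_iff, intCast_val_sub_val_add]
  refine ⟨Matrix.of fun i j => Real.sin (θ i - θ j + Real.pi * s / n) *
    Real.sin (θ i - θ j + -(Real.pi * s / n)), fun i j => ?_, ?_, ?_⟩
  · have h := harg' i j (-s)
    push_cast at h
    rw [show Real.pi * -(s : ℝ) / n = -(Real.pi * s / n) by ring] at h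
    rw [Matrix.of_apply, mul_eq_zero, harg', h, Finset.mem_insert, Finset.mem_singleton, or_comm,
      add_neg_eq_zero, add_eq_zero_iff_eq_neg]
  · ext i j
    simp only [Matrix.transpose_apply, Matrix.of_apply, hA]
    rw [show 2 * (θ j - θ i) = -(2 * (θ i - θ j)) by ring, Real.cos_neg]
  · refine rank_le_of_eq_sum
      ![fun _ => 1, fun i => Real.cos (2 * θ i), fun i => Real.sin (2 * θ i)]
      ![fun _ => Real.cos (2 * (Real.pi * s / n)) / 2, fun j => -Real.cos (2 * θ j) / 2,
        fun j => -Real.sin (2 * θ j) / 2] fun i j => ?_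
    simp only [Matrix.of_apply, hA, mul_sub, Real.cos_sub, Fin.sum_univ_three,
      Matrix.cons_val]
    ring

/-- For `n = 2h`, a symmetric matrix of rank at most four vanishing exactly when
`i - j` is `h` or `h ± 2`. -/
lemma exists_rank_le_four {h : ℕ} (hn : n = 2 * h) : ∃ A : Matrix (ZMod n) (ZMod n) ℝ,
    (∀ i j, A i j = 0 ↔
        i - j ∈ ({(h : ZMod n), (h : ZMod n) + 2, (h : ZMod n) - 2} : Finset (ZMod n))) ∧
      A.IsSymm ∧ A.rank ≤ 4 := by
  have hn0 : (n : ℝ) ≠ 0 := NeZero.ne _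
  have hA : ∀ x b : ℝ, Real.cos x * Real.cos (x + b) * Real.cos (x - b) =
      Real.cos (3 * x) / 4 + (Real.cos b ^ 2 - 1 / 4) * Real.cos x := by
    intro x b
    rw [Real.cos_three_mul, Real.cos_add, Real.cos_sub]
    linear_combination (-Real.cos x * Real.sin b ^ 2) * Real.sin_sq_add_cos_sq x
      + (-Real.cos x * (1 - Real.cos x ^ 2)) * Real.sin_sq_add_cos_sq b
  set θ : ZMod n → ℝ := fun i => Real.pi * i.val / n with hθ
  have hcos : ∀ (i j : ZMod n) (c : ℤ), Real.cos (θ i - θ j + Real.pi * c / n) = 0 ↔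
      i - j = h - c := by
    intro i j c
    have : θ i - θ j + Real.pi * c / n =
        Real.pi * ((i.val - j.val + (c - h) : ℤ) : ℝ) / n + Real.pi / 2 := by
      have : (n : ℝ) = 2 * h := by exact_mod_cast hn
      simp only [hθ]
      push_cast
      field_simp
      rw [this]
      ring
    rw [this, Real.cos_add_pi_div_two, neg_eq_zero, sin_pi_mul_div_eq_zero_iff,
      intCast_val_sub_val_add]
    push_cast
    constructor <;> intro h' <;> linear_combination h'
  refine ⟨Matrix.of fun i j => Real.cos (θ i - θ j) * Real.cos (θ i - θ j + Real.pi * 2 / n) *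
    Real.cos (θ i - θ j - Real.pi * 2 / n), fun i j => ?_, ?_, ?_⟩
  · have h₀ := hcos i j 0
    have h₁ := hcos i j 2
    have h₂ := hcos i j (-2)
    push_cast at h₀ h₁ h₂
    rw [mul_zero, zero_div, add_zero, sub_zero] at h₀
    rw [show Real.pi * -2 / (n : ℝ) = -(Real.pi * 2 / n) by ring, ← sub_eq_add_neg,
      sub_neg_eq_add] at h₂
    rw [Matrix.of_apply, mul_eq_zero, mul_eq_zero, h₀, h₁, h₂]
    simp only [Finset.mem_insert, Finset.mem_singleton]
    tauto
  · ext i j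
    simp only [Matrix.transpose_apply, Matrix.of_apply, hA]
    rw [show θ j - θ i = -(θ i - θ j) by ring, mul_neg, Real.cos_neg, Real.cos_neg]
  · refine rank_le_of_eq_sum
      ![fun i => Real.cos (3 * θ i), fun i => Real.sin (3 * θ i),
        fun i => Real.cos (θ i), fun i => Real.sin (θ i)]
      ![fun j => Real.cos (3 * θ j) / 4, fun j => Real.sin (3 * θ j) / 4,
        fun j => (Real.cos (Real.pi * 2 / n) ^ 2 - 1 / 4) * Real.cos (θ j),
        fun j => (Real.cos (Real.pi * 2 / n) ^ 2 - 1 / 4) * Real.sin (θ j)] fun i j => ?_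
    rw [Matrix.of_apply, hA, mul_sub, Real.cos_sub, Real.cos_sub]
    simp only [Fin.sum_univ_four, Matrix.cons_val]
    ring

lemma circG_adj_iff_of_odd {s : ℕ} (hs : 4 ≤ s) (hn : n = 2 * s + 3) (i j : ZMod n) :
    (circG n (Set.Icc 1 ((n + 1) / 2 - 1) \ {(n + 1) / 2 - 2})).Adj i j ↔
      i ≠ j ∧ j - i ∉ ({(s : ZMod n), -(s : ZMod n)} : Finset (ZMod n)) := by
  rw [circG_adj]
  refine and_congr_right fun hij => ?_
  simp only [Set.mem_sdiff, Set.mem_Icc, Set.mem_singleton_iff, Finset.mem_insert,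
    Finset.mem_singleton]
  constructor
  · rintro ⟨t, ht, h | h⟩ (h' | h')
    · have : ((t - s : ℤ) : ZMod n) = 0 := by
        push_cast at h ⊢; linear_combination h' - h
      have := intCast_eq_zero_cases this (by omega) (by omega)
      omega
    · have : ((t + s : ℤ) : ZMod n) = 0 := by
        push_cast at h ⊢; linear_combination h' - h
      have := intCast_eq_zero_cases this (by omega) (by omega)
      omega
    · have : ((t + s : ℤ) : ZMod n) = 0 := by
        push_cast at h ⊢; linear_combination h - h'
      have := intCast_eq_zero_cases this (by omega) (by omega)
      omega
    · have : ((t - s : ℤ) : ZMod n) = 0 := by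
        push_cast at h ⊢; linear_combination h - h'
      have := intCast_eq_zero_cases this (by omega) (by omega)
      omega
  · intro h
    have hv := ZMod.natCast_zmod_val (j - i)
    have hlt := ZMod.val_lt (j - i)
    have hn0 := ZMod.natCast_self n
    have h0 : (j - i).val ≠ 0 := by
      rw [ne_eq, ZMod.val_eq_zero, sub_eq_zero]; exact hij.symm
    generalize (j - i).val = v at *
    have h1 : v ≠ s := fun hv' => h (Or.inl (by rw [← hv, hv']))
    have h2 : n - v ≠ s := fun hv' => h (Or.inr (by
      have : ((v + s : ℕ) : ZMod n) = 0 := by rw [← hv', Nat.add_sub_cancel' hlt.le, hn0]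
      push_cast at this
      linear_combination this - hv))
    by_cases hvs : v ≤ s + 1
    · exact ⟨v, by omega, Or.inl (by rw [← hv]; simp)⟩
    · exact ⟨n - v, by omega, Or.inr (by rw [← hv]; push_cast [Nat.cast_sub hlt.le]; simp)⟩

lemma circG_adj_iff_of_even {h : ℕ} (hh : 5 ≤ h) (hn : n = 2 * h) (i j : ZMod n) :
    (circG n (Set.Icc 1 ((n + 1) / 2 - 1) \ {(n + 1) / 2 - 2})).Adj i j ↔
      i ≠ j ∧ j - i ∉ ({(h : ZMod n), (h : ZMod n) + 2, (h : ZMod n) - 2} : Finset (ZMod n)) := by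
  rw [circG_adj]
  refine and_congr_right fun hij => ?_
  simp only [Set.mem_sdiff, Set.mem_Icc, Set.mem_singleton_iff, Finset.mem_insert,
    Finset.mem_singleton]
  constructor
  · rintro ⟨t, ht, e | e⟩ e'
    · have : ((t - h : ℤ) : ZMod n) = 0 ∨ ((t - h - 2 : ℤ) : ZMod n) = 0 ∨
          ((t - h + 2 : ℤ) : ZMod n) = 0 := by
        push_cast at e ⊢
        refine e'.imp (fun h' => ?_) (Or.imp (fun h' => ?_) (fun h' => ?_)) <;>
          linear_combination h' - e
      rcases this with h' | h' | h' <;>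
      · have := intCast_eq_zero_cases h' (by omega) (by omega)
        omega
    · have : ((t + h : ℤ) : ZMod n) = 0 ∨ ((t + h + 2 : ℤ) : ZMod n) = 0 ∨
          ((t + h - 2 : ℤ) : ZMod n) = 0 := by
        push_cast at e ⊢
        refine e'.imp (fun h' => ?_) (Or.imp (fun h' => ?_) (fun h' => ?_)) <;>
          linear_combination e - h'
      rcases this with h' | h' | h' <;>
      · have := intCast_eq_zero_cases h' (by omega) (by omega)
        omega
  · intro h'
    have hv := ZMod.natCast_zmod_val (j - i)
    have hlt := ZMod.val_lt (j - i)
    have h0 : (j - i).val ≠ 0 := by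
      rw [ne_eq, ZMod.val_eq_zero, sub_eq_zero]; exact hij.symm
    generalize (j - i).val = v at *
    have h1 : v ≠ h := fun hv' => h' (Or.inl (by rw [← hv, hv']))
    have h2 : v ≠ h + 2 := fun hv' => h' (Or.inr (Or.inl (by rw [← hv, hv']; simp)))
    have h3 : v + 2 ≠ h := fun hv' => h' (Or.inr (Or.inr (by rw [← hv, ← hv']; simp)))
    by_cases hvs : v ≤ h
    · exact ⟨v, by omega, Or.inl (by rw [← hv]; simp)⟩
    · exact ⟨n - v, by omega, Or.inr (by rw [← hv]; push_cast [Nat.cast_sub hlt.le]; simp)⟩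

lemma parameters_of_odd {s : ℕ} (hs : 4 ≤ s) (hn : n = 2 * s + 3) {G : SimpleGraph (ZMod n)}
    (hG : ∀ i j, G.Adj i j ↔
      i ≠ j ∧ j - i ∉ ({(s : ZMod n), -(s : ZMod n)} : Finset (ZMod n))) :
    vertexConnectivity G = n - (2 + 1) ∧ minDeg G = n - (2 + 1) ∧ xi G = n - (2 + 1) ∧
      maxNullity ℝ G = n - (2 + 1) ∧ zfn G = n - (2 + 1) := by
  have hk : ∀ k : ℤ, k ≠ 0 → -4 ≤ k → k ≤ 4 → (k : ZMod n) * s ≠ 0 := by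
    intro k hk h₁ h₂ h
    have : ((k * s : ℤ) : ZMod n) = 0 := by push_cast; exact h
    have := intCast_eq_zero_cases this (by nlinarith) (by nlinarith)
    interval_cases k <;> omega
  have k₁ := hk 1 (by norm_num) (by norm_num) (by norm_num)
  have k₂ := hk 2 (by norm_num) (by norm_num) (by norm_num)
  have k₃ := hk 3 (by norm_num) (by norm_num) (by norm_num)
  have k₄ := hk 4 (by norm_num) (by norm_num) (by norm_num)
  push_cast at k₁ k₂ k₃ k₄
  obtain ⟨A, hA, hsymm, hrank⟩ := exists_rank_le_three (n := n) s
  rw [Int.cast_natCast] at hA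
  generalize (s : ZMod n) = x at *
  have hx : x ≠ -x := fun h => k₂ (by linear_combination h)
  have hcard : ({x, -x} : Finset (ZMod n)).card = 2 := Finset.card_pair hx
  have main := parameters_eq hG ?_ ⟨x, by simp⟩ (by omega) (by omega) ?_ ?_ ?_ hA hsymm (by omega)
  · rwa [hcard] at main
  all_goals simp only [Finset.mem_insert, Finset.mem_singleton]
  · rintro (h | h)
    · exact k₁ (by linear_combination -h)
    · exact k₁ (by linear_combination h)
  · rintro t (rfl | rfl) <;> simp
  · intro d hd
    by_contra! h
    rcases h x (Or.inl rfl) with h₁ | h₁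
    · exact hd (by linear_combination h₁)
    rcases h (-x) (Or.inr rfl) with h₂ | h₂
    · exact k₄ (by linear_combination h₁ - h₂)
    · exact hd (by linear_combination h₂)
  · intro T' hsub hne
    have hT' : ∀ t ∈ T', t = x ∨ t = -x := fun t ht => by simpa using hsub ht
    by_cases h : -x ∈ T'
    · refine ⟨2 * x, fun h' => ?_, -x, h, ?_, fun t ht htx => ?_⟩
      · rcases hT' _ h' with h | h
        · exact k₁ (by linear_combination h)
        · exact k₃ (by linear_combination h)
      · rintro (h | h)
        · exact k₂ (by linear_combination h)
        · exact k₄ (by linear_combination h)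
      · exact Or.inl (by linear_combination -(hT' t ht).resolve_right htx)
    · have hTx : ∀ t ∈ T', t = x := fun t ht =>
        (hT' t ht).resolve_right fun h' => h (h' ▸ ht)
      obtain ⟨t, ht⟩ := hne
      refine ⟨-x, h, x, hTx t ht ▸ ht, ?_, fun t ht htx => absurd (hTx t ht) htx⟩
      rintro (h | h)
      · exact k₃ (by linear_combination -h)
      · exact k₁ (by linear_combination -h)

lemma parameters_of_even {h : ℕ} (hh : 5 ≤ h) (hn : n = 2 * h) {G : SimpleGraph (ZMod n)}
    (hG : ∀ i j, G.Adj i j ↔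
      i ≠ j ∧ j - i ∉ ({(h : ZMod n), (h : ZMod n) + 2, (h : ZMod n) - 2} : Finset (ZMod n))) :
    vertexConnectivity G = n - (3 + 1) ∧ minDeg G = n - (3 + 1) ∧ xi G = n - (3 + 1) ∧
      maxNullity ℝ G = n - (3 + 1) ∧ zfn G = n - (3 + 1) := by
  have hz : ∀ a : ℤ, a ≠ 0 → -8 ≤ a → a ≤ 8 → (a : ZMod n) ≠ 0 := by
    intro a ha h₁ h₂ h
    have := intCast_eq_zero_cases h (by omega) (by omega)
    omega
  have hz' : ∀ a : ℤ, -4 ≤ a → a ≤ 4 → (h : ZMod n) + a ≠ 0 := by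
    intro a h₁ h₂ e
    have : ((h + a : ℤ) : ZMod n) = 0 := by push_cast; exact e
    have := intCast_eq_zero_cases this (by omega) (by omega)
    omega
  have hx2 : 2 * (h : ZMod n) = 0 := by
    have := ZMod.natCast_self n
    rw [show ((n : ℕ) : ZMod n) = ((2 * h : ℕ) : ZMod n) from congrArg _ hn] at this
    exact_mod_cast this
  have z₂ := hz 2 (by norm_num) (by norm_num) (by norm_num)
  have z₄ := hz 4 (by norm_num) (by norm_num) (by norm_num)
  have z₆ := hz 6 (by norm_num) (by norm_num) (by norm_num)
  have x₀ := hz' 0 (by norm_num) (by norm_num)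
  have x₂ := hz' 2 (by norm_num) (by norm_num)
  have y₂ := hz' (-2) (by norm_num) (by norm_num)
  have x₄ := hz' 4 (by norm_num) (by norm_num)
  have y₄ := hz' (-4) (by norm_num) (by norm_num)
  push_cast at z₂ z₄ z₆ x₀ x₂ y₂ x₄ y₄
  obtain ⟨A, hA, hsymm, hrank⟩ := exists_rank_le_four hn
  generalize (h : ZMod n) = x at *
  have hcard : ({x, x + 2, x - 2} : Finset (ZMod n)).card = 3 :=
    Finset.card_eq_three.2 ⟨x, x + 2, x - 2,
      fun h => z₂ (by linear_combination -h), fun h => z₂ (by linear_combination h),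
      fun h => z₄ (by linear_combination h), rfl⟩
  have main := parameters_eq hG ?_ ⟨x, by simp⟩ (by omega) (by omega) ?_ ?_ ?_ hA hsymm (by omega)
  · rwa [hcard] at main
  all_goals simp only [Finset.mem_insert, Finset.mem_singleton]
  · rintro (h | h | h)
    · exact x₀ (by linear_combination -h)
    · exact x₂ (by linear_combination -h)
    · exact y₂ (by linear_combination -h)
  · rintro t (rfl | rfl | rfl)
    · exact Or.inl (by linear_combination -hx2)
    · exact Or.inr (Or.inr (by linear_combination -hx2))
    · exact Or.inr (Or.inl (by linear_combination -hx2))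
  · intro d hd
    by_contra! h
    rcases h x (Or.inl rfl) with h₁ | h₁ | h₁
    · exact hd (by linear_combination h₁)
    · rcases h (x + 2) (Or.inr (Or.inl rfl)) with h₂ | h₂ | h₂
      · exact z₄ (by linear_combination h₂ - h₁)
      · exact z₂ (by linear_combination h₂ - h₁)
      · exact z₆ (by linear_combination h₂ - h₁)
    · rcases h (x - 2) (Or.inr (Or.inr rfl)) with h₂ | h₂ | h₂
      · exact z₄ (by linear_combination h₁ - h₂)
      · exact z₆ (by linear_combination h₁ - h₂)
      · exact z₂ (by linear_combination h₁ - h₂)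
  · intro T' hsub hne
    have hT' : ∀ t ∈ T', t = x ∨ t = x + 2 ∨ t = x - 2 := fun t ht => by simpa using hsub ht
    by_cases hm : x - 2 ∈ T'
    · refine ⟨2, fun h' => ?_, x - 2, hm, ?_, fun t ht htx => ?_⟩
      · rcases hT' _ h' with h | h | h
        · exact y₂ (by linear_combination -h)
        · exact x₀ (by linear_combination -h)
        · exact y₄ (by linear_combination -h)
      · rintro (h | h | h)
        · exact z₄ (by linear_combination h + hx2)
        · exact z₂ (by linear_combination h + hx2)
        · exact z₆ (by linear_combination h + hx2)
      · rcases hT' t ht with h | h | h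
        · exact Or.inr (Or.inl (by linear_combination -h - hx2))
        · exact Or.inl (by linear_combination -h - hx2)
        · exact absurd h htx
    by_cases hp : x + 2 ∈ T'
    · refine ⟨-2, fun h' => ?_, x + 2, hp, ?_, fun t ht htx => ?_⟩
      · rcases hT' _ h' with h | h | h
        · exact x₂ (by linear_combination -h)
        · exact x₄ (by linear_combination -h)
        · exact x₀ (by linear_combination -h)
      · rintro (h | h | h)
        · exact z₄ (by linear_combination -h - hx2)
        · exact z₆ (by linear_combination -h - hx2)
        · exact z₂ (by linear_combination -h - hx2)
      · rcases hT' t ht with h | h | h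
        · exact Or.inr (Or.inr (by linear_combination -h - hx2))
        · exact absurd h htx
        · exact absurd (h ▸ ht) hm
    · have hTx : ∀ t ∈ T', t = x := fun t ht => by
        rcases hT' t ht with h | h | h
        · exact h
        · exact absurd (h ▸ ht) hp
        · exact absurd (h ▸ ht) hm
      obtain ⟨t, ht⟩ := hne
      refine ⟨4, fun h => y₄ (by linear_combination -hTx _ h), x, hTx t ht ▸ ht, ?_,
        fun t ht htx => absurd (hTx t ht) htx⟩
      rintro (h | h | h)
      · exact z₄ (by linear_combination h + hx2)
      · exact z₂ (by linear_combination h + hx2)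
      · exact z₆ (by linear_combination h + hx2)

end Circulant

theorem stmt15 (n : ℕ) (hn : 10 ≤ n) :
    haveI : NeZero n := ⟨by omega⟩
    vertexConnectivity (circG n (Set.Icc 1 ((n + 1) / 2 - 1) \ {(n + 1) / 2 - 2}))
        = 2 * ((n + 1) / 2 - 2) ∧
    minDeg (circG n (Set.Icc 1 ((n + 1) / 2 - 1) \ {(n + 1) / 2 - 2}))
        = 2 * ((n + 1) / 2 - 2) ∧
    xi (circG n (Set.Icc 1 ((n + 1) / 2 - 1) \ {(n + 1) / 2 - 2}))
        = 2 * ((n + 1) / 2 - 2) ∧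
    maxNullity ℝ (circG n (Set.Icc 1 ((n + 1) / 2 - 1) \ {(n + 1) / 2 - 2}))
        = 2 * ((n + 1) / 2 - 2) ∧
    zfn (circG n (Set.Icc 1 ((n + 1) / 2 - 1) \ {(n + 1) / 2 - 2}))
        = 2 * ((n + 1) / 2 - 2) := by
  have : NeZero n := ⟨by omega⟩
  obtain ⟨s, rfl | rfl⟩ : ∃ s, n = 2 * s + 3 ∨ n = 2 * s :=
    ⟨if n % 2 = 0 then n / 2 else (n - 3) / 2, by split <;> omega⟩
  · rw [show 2 * ((2 * s + 3 + 1) / 2 - 2) = 2 * s + 3 - (2 + 1) by omega]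
    exact parameters_of_odd (by omega) rfl (circG_adj_iff_of_odd (by omega) rfl)
  · rw [show 2 * ((2 * s + 1) / 2 - 2) = 2 * s - (3 + 1) by omega]
    exact parameters_of_even (by omega) rfl (circG_adj_iff_of_even (by omega) rfl)

end Paper
end
end

section
/- Let k ≥ 1 and n ≥ 3 be integers and let S ⊆ {1,...,⌈n/2⌉ − 1} be nonempty. Then every eigenvalue (over ℝ) of the adjacency matrix of Circ[n,S] is an eigenvalue of the adjacency matrix of Circ[nk,S]; in particular, null(A(Circ[n,S])) ≤ null(A(Circ[nk,S])), where null denotes the nullity of the matrix over ℝ. -/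
open scoped Classical

noncomputable section

namespace Paper

variable {V : Type*}

theorem circG_adj_iff {N : ℕ} {S : Set ℕ} (hS : ∀ s ∈ S, 1 ≤ s ∧ 2 * s < N) (i j : ZMod N) :
    (circG N S).Adj i j ↔ ∃ t : ℤ, t.natAbs ∈ S ∧ j = i + (t : ZMod N) := by
  rw [circG, SimpleGraph.fromRel_adj]
  constructor
  · rintro ⟨-, ⟨s, hs, rfl⟩ | ⟨s, hs, rfl⟩⟩
    · exact ⟨s, by simpa using hs, by simp⟩
    · exact ⟨-s, by simpa using hs, by simp⟩
  · rintro ⟨t, ht, rfl⟩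
    refine ⟨fun h => ?_, ?_⟩
    · have h0 : (t : ZMod N) = 0 := by simpa using h
      have hle := Nat.le_of_dvd (hS _ ht).1
        (Int.natCast_dvd.mp ((ZMod.intCast_zmod_eq_zero_iff_dvd t N).mp h0))
      have := hS _ ht
      omega
    · rcases Int.natAbs_eq t with h | h
      · exact Or.inl ⟨_, ht, by rw [h]; simp⟩
      · refine Or.inr ⟨_, ht, ?_⟩
        conv_lhs => rw [← add_zero i]
        rw [add_assoc]
        congr 1
        rw [← Int.cast_natCast, ← Int.cast_add, ← Int.cast_zero]
        congr 1
        omega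

/-- Multiplication by the adjacency matrices of circulant graphs with the same connection set
commutes with pulling functions back along the projection `ZMod N → ZMod n`. -/
theorem adjMat_circG_mulVec_comp_castHom {R : Type*} [NonAssocSemiring R] {n N : ℕ}
    [NeZero n] [NeZero N] (h : n ∣ N) {S : Set ℕ} (hS : ∀ s ∈ S, 1 ≤ s ∧ 2 * s < n)
    (x : ZMod n → R) :
    (adjMat R (circG N S)).mulVec (x ∘ ZMod.castHom h (ZMod n)) =
      (adjMat R (circG n S)).mulVec x ∘ ZMod.castHom h (ZMod n) := by
  have hle : n ≤ N := Nat.le_of_dvd (NeZero.pos N) h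
  have hS' : ∀ s ∈ S, 1 ≤ s ∧ 2 * s < N := fun s hs =>
    ⟨(hS s hs).1, (hS s hs).2.trans_le hle⟩
  ext i
  simp only [Matrix.mulVec, dotProduct, adjMat, Matrix.of_apply, Function.comp_apply, ite_mul,
    one_mul, zero_mul, ← Finset.sum_filter]
  refine Finset.sum_nbij (ZMod.castHom h (ZMod n)) ?_ ?_ ?_ fun _ _ => rfl
  · intro j hj
    simp only [Finset.mem_filter, Finset.mem_univ, true_and, circG_adj_iff hS,
      circG_adj_iff hS'] at hj ⊢
    obtain ⟨t, ht, rfl⟩ := hj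
    exact ⟨t, ht, by rw [map_add, map_intCast]⟩
  · intro j hj j' hj' hjj'
    simp only [Finset.coe_filter, Finset.mem_univ, true_and, Set.mem_ofPred_eq,
      circG_adj_iff hS'] at hj hj'
    obtain ⟨t, ht, rfl⟩ := hj
    obtain ⟨t', ht', rfl⟩ := hj'
    rw [map_add, map_add, map_intCast, map_intCast, add_right_inj,
      ZMod.intCast_eq_intCast_iff_dvd_sub] at hjj'
    have h0 : t' - t = 0 := by
      refine Int.eq_zero_of_abs_lt_dvd hjj' ?_
      have h1 := hS _ ht
      have h2 := hS _ ht'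
      rw [abs_lt]
      omega
    rw [sub_eq_zero.mp h0]
  · intro j' hj'
    simp only [Finset.coe_filter, Finset.mem_univ, true_and, Set.mem_ofPred_eq,
      circG_adj_iff hS, circG_adj_iff hS', Set.mem_image] at hj' ⊢
    obtain ⟨t, ht, rfl⟩ := hj'
    exact ⟨i + t, ⟨t, ht, rfl⟩, by rw [map_add, map_intCast]⟩

theorem card_sub_rank_eq_finrank_ker {K m : Type*} [Field K] [Fintype m] (A : Matrix m m K) :
    Fintype.card m - A.rank = Module.finrank K (LinearMap.ker A.mulVecLin) := by
  have := A.mulVecLin.finrank_range_add_finrank_ker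
  rw [Module.finrank_fintype_fun_eq_card] at this
  rw [Matrix.rank]
  omega

theorem card_sub_rank_le_of_mulVec_comp {K m l : Type*} [Field K] [Fintype m] [Fintype l]
    {A : Matrix m m K} {B : Matrix l l K} {f : l → m} (hf : Function.Surjective f)
    (hAB : ∀ x : m → K, B.mulVec (x ∘ f) = A.mulVec x ∘ f) :
    Fintype.card m - A.rank ≤ Fintype.card l - B.rank := by
  rw [card_sub_rank_eq_finrank_ker, card_sub_rank_eq_finrank_ker]
  have hker : ∀ x ∈ LinearMap.ker A.mulVecLin,
      LinearMap.funLeft K K f x ∈ LinearMap.ker B.mulVecLin := by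
    intro x hx
    rw [LinearMap.mem_ker, Matrix.mulVecLin_apply] at hx ⊢
    exact (hAB x).trans (by rw [hx]; rfl)
  refine LinearMap.finrank_le_finrank_of_injective
    (f := (LinearMap.funLeft K K f).restrict hker) fun x y hxy => ?_
  exact Subtype.ext (LinearMap.funLeft_injective_of_surjective K K f hf
    (congrArg Subtype.val hxy))

theorem stmt17 (n k : ℕ) (hn : 3 ≤ n) (hk : 1 ≤ k) (S : Set ℕ)
    (hSsub : S ⊆ Set.Icc 1 ((n + 1) / 2 - 1)) :
    haveI : NeZero n := ⟨by omega⟩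
    haveI : NeZero (n * k) := ⟨Nat.mul_ne_zero (by omega) (by omega)⟩
    (∀ μ : ℝ,
        (∃ x : ZMod n → ℝ, x ≠ 0 ∧ (adjMat ℝ (circG n S)).mulVec x = μ • x) →
        ∃ y : ZMod (n * k) → ℝ, y ≠ 0 ∧ (adjMat ℝ (circG (n * k) S)).mulVec y = μ • y) ∧
    Fintype.card (ZMod n) - (adjMat ℝ (circG n S)).rank ≤
      Fintype.card (ZMod (n * k)) - (adjMat ℝ (circG (n * k) S)).rank := by
  have : NeZero n := ⟨by omega⟩
  have : NeZero (n * k) := ⟨Nat.mul_ne_zero (by omega) (by omega)⟩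
  have hdvd : n ∣ n * k := Dvd.intro k rfl
  have hS : ∀ s ∈ S, 1 ≤ s ∧ 2 * s < n := fun s hs => by
    have := hSsub hs
    rw [Set.mem_Icc] at this
    omega
  have hsurj : Function.Surjective (ZMod.castHom hdvd (ZMod n)) :=
    ZMod.castHom_surjective hdvd
  refine ⟨?_, card_sub_rank_le_of_mulVec_comp hsurj
    (adjMat_circG_mulVec_comp_castHom hdvd hS)⟩
  rintro μ ⟨x, hx, hxμ⟩
  refine ⟨x ∘ ZMod.castHom hdvd (ZMod n), fun h0 => hx ?_, ?_⟩
  · exact hsurj.injective_comp_right h0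
  · rw [adjMat_circG_mulVec_comp_castHom hdvd hS, hxμ]
    rfl

end Paper
end
end

section
/- Let q be a nonnegative integer and let G = ECG(6q+1, 6q+1). Then for every field F, the adjacency matrix A(G), with entries interpreted in F, has rank |G| − 4 = mr(F,G), and M(F,G) = Z(G) = 4; that is, G has field independent minimum rank and A(G) is a universally optimal matrix. -/
open scoped Classical

noncomputable section

namespace Paper

variable {V : Type*}

/-- The extended cube graph `ECG(t,k)` on `n = 2t + 2k + 8` vertices. -/
def ECG (t k : ℕ) : SimpleGraph (ZMod (2 * t + 2 * k + 8)) :=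
  SimpleGraph.fromRel (fun a b =>
    b = a + 1 ∨
    (∃ i : ℕ, i ≤ k + 1 ∧ a = (i : ZMod (2 * t + 2 * k + 8)) ∧
      b = ((2 * t + 2 * k + 8 - t - 3 - i : ℕ) : ZMod (2 * t + 2 * k + 8))) ∨
    (∃ i : ℕ, k + 2 ≤ i ∧ i ≤ t + k + 3 ∧ a = (i : ZMod (2 * t + 2 * k + 8)) ∧
      b = ((2 * t + 2 * k + 8 + k + 1 - i : ℕ) : ZMod (2 * t + 2 * k + 8))))

instance ecgNeZero (t k : ℕ) : NeZero (2 * t + 2 * k + 8) := ⟨by omega⟩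

/-! ### Zero forcing bounds the nullity -/

theorem Forced.eq_zero {F : Type*} [Field F] [Fintype V] {G : SimpleGraph V} {A : Matrix V V F}
    (hA : SMat F G A) {Z : Set V} {x : V → F} (hx : A.mulVec x = 0) (hZ : ∀ v ∈ Z, x v = 0)
    {v : V} (hv : Forced G Z v) : x v = 0 := by
  induction hv with
  | init v hv => exact hZ v hv
  | force u w _ huw _ hu ih =>
    have hsum : ∑ y, A u y * x y = 0 := congrFun hx u
    rw [Finset.sum_eq_single w] at hsum
    · exact (mul_eq_zero.mp hsum).resolve_left ((hA.2 u w huw.ne).mpr huw)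
    · intro y _ hyw
      by_cases hyu : y = u
      · rw [hyu, hu, mul_zero]
      · by_cases h : G.Adj u y
        · rw [ih y h hyw, mul_zero]
        · rw [not_not.mp (mt (hA.2 u y (Ne.symm hyu)).mp h), zero_mul]
    · simp

theorem rank_add_finrank_ker {F : Type*} [Field F] [Fintype V] (A : Matrix V V F) :
    A.rank + Module.finrank F (LinearMap.ker A.mulVecLin) = Fintype.card V := by
  rw [Matrix.rank, LinearMap.finrank_range_add_finrank_ker, Module.finrank_fintype_fun_eq_card]

theorem IsZeroForcingSet.card_le_rank_add_ncard {F : Type*} [Field F] [Fintype V]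
    {G : SimpleGraph V} {A : Matrix V V F} (hA : SMat F G A) {Z : Set V}
    (hZ : IsZeroForcingSet G Z) : Fintype.card V ≤ A.rank + Z.ncard := by
  rw [← rank_add_finrank_ker A]
  let restrict : LinearMap.ker A.mulVecLin →ₗ[F] (Z → F) :=
    (LinearMap.funLeft F F ((↑) : Z → V)).comp (LinearMap.ker A.mulVecLin).subtype
  have hinj : Function.Injective restrict := by
    rw [injective_iff_map_eq_zero]
    rintro ⟨x, hx⟩ h
    ext v
    exact (hZ v).eq_zero hA hx fun z hz => congrFun h ⟨z, hz⟩
  have := LinearMap.finrank_le_finrank_of_injective hinj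
  rw [Module.finrank_fintype_fun_eq_card, ← Nat.card_eq_fintype_card,
    Nat.card_coe_set_eq] at this
  omega

theorem rank_add_card_le_of_forall_extend {F ι : Type*} [Field F] [Fintype V] [Fintype ι]
    (A : Matrix V V F) (e : ι → V) (h : ∀ c : ι → F, ∃ x, A.mulVec x = 0 ∧ ∀ i, x (e i) = c i) :
    A.rank + Fintype.card ι ≤ Fintype.card V := by
  rw [← rank_add_finrank_ker A]
  let restrict : LinearMap.ker A.mulVecLin →ₗ[F] (ι → F) :=
    (LinearMap.funLeft F F e).comp (LinearMap.ker A.mulVecLin).subtype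
  have hsurj : Function.Surjective restrict := fun c => by
    obtain ⟨x, hx, hxc⟩ := h c
    exact ⟨⟨x, hx⟩, funext hxc⟩
  have := LinearMap.finrank_le_finrank_of_surjective hsurj
  rw [Module.finrank_fintype_fun_eq_card] at this
  omega

theorem sMat_adjMat (F : Type*) [Field F] (G : SimpleGraph V) : SMat F G (adjMat F G) := by
  constructor
  · ext i j
    simp [adjMat, G.adj_comm]
  · intro i j _
    simp [adjMat]

/-- If a zero forcing set has as many elements as the nullity of the adjacency matrix, both
are optimal. -/
theorem adjMat_optimal {F : Type*} [Field F] [Fintype V] {G : SimpleGraph V} {Z : Set V}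
    (hZ : IsZeroForcingSet G Z) (h : (adjMat F G).rank + Z.ncard ≤ Fintype.card V) :
    (adjMat F G).rank = Fintype.card V - Z.ncard ∧ minRank F G = (adjMat F G).rank ∧
      maxNullity F G = zfn G ∧ zfn G = Z.ncard := by
  have hadj := sMat_adjMat F G
  have hle := hZ.card_le_rank_add_ncard hadj
  have hzfn : zfn G = Z.ncard := by
    refine IsLeast.csInf_eq ⟨⟨Z, rfl, hZ⟩, ?_⟩
    rintro m ⟨Z', rfl, hZ'⟩
    have := hZ'.card_le_rank_add_ncard hadj
    omega
  refine ⟨by omega, ?_, ?_, hzfn⟩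
  · refine IsLeast.csInf_eq ⟨⟨_, hadj, rfl⟩, ?_⟩
    rintro m ⟨A, hA, rfl⟩
    have := hZ.card_le_rank_add_ncard hA
    omega
  · rw [hzfn]
    refine IsGreatest.csSup_eq ⟨⟨_, hadj, by omega⟩, ?_⟩
    rintro m ⟨A, hA, rfl⟩
    have := hZ.card_le_rank_add_ncard hA
    omega

/-! ### Neighbors in `ECG (6q+1) (6q+1)` -/

theorem eq_natCast_iff_val {n x : ℕ} [NeZero n] (hx : x < n) (a : ZMod n) :
    a = (x : ZMod n) ↔ a.val = x := by
  constructor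
  · rintro rfl
    exact ZMod.val_cast_of_lt hx
  · rintro rfl
    exact (ZMod.natCast_zmod_val a).symm

theorem eq_add_one_iff_val {n : ℕ} [NeZero n] (a b : ZMod n) :
    b = a + 1 ↔ b.val = a.val + 1 ∨ (a.val + 1 = n ∧ b.val = 0) := by
  have ha := ZMod.val_lt a
  have hb := ZMod.val_lt b
  have h : a + 1 = ((a.val + 1 : ℕ) : ZMod n) := by simp
  rw [h]
  rcases Nat.lt_or_ge (a.val + 1) n with hlt | hge
  · rw [eq_natCast_iff_val hlt]
    omega
  · have hn : a.val + 1 = n := by omega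
    rw [hn, ZMod.natCast_self, ← ZMod.val_eq_zero]
    omega

/-- The vertex labelled `m` modulo `n`. -/
abbrev ecgVertex (q m : ℕ) : ZMod (2 * (6 * q + 1) + 2 * (6 * q + 1) + 8) := m

theorem val_ecgVertex {q m : ℕ} (hm : m < 24 * q + 12) : (ecgVertex q m).val = m :=
  ZMod.val_cast_of_lt (by omega)

theorem ecg_adj_iff_val (q : ℕ) (a b : ZMod (2 * (6 * q + 1) + 2 * (6 * q + 1) + 8)) :
    (ECG (6 * q + 1) (6 * q + 1)).Adj a b ↔
      b.val = a.val + 1 ∨ a.val = b.val + 1 ∨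
      (a.val = 0 ∧ b.val = 24 * q + 11) ∨ (b.val = 0 ∧ a.val = 24 * q + 11) ∨
      (a.val + b.val = 18 * q + 8 ∧ (a.val < 6 * q + 3 ∨ b.val < 6 * q + 3)) ∨
      (a.val + b.val = 30 * q + 14 ∧ (6 * q + 3 ≤ a.val ∧ a.val < 12 * q + 6 ∨
        6 * q + 3 ≤ b.val ∧ b.val < 12 * q + 6)) := by
  have ha := ZMod.val_lt a
  have hb := ZMod.val_lt b
  have vertical : ∀ a b : ZMod (2 * (6 * q + 1) + 2 * (6 * q + 1) + 8),
      (∃ i : ℕ, i ≤ 6 * q + 1 + 1 ∧ a = i ∧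
        b = ((2 * (6 * q + 1) + 2 * (6 * q + 1) + 8 - (6 * q + 1) - 3 - i : ℕ) :
          ZMod (2 * (6 * q + 1) + 2 * (6 * q + 1) + 8))) ↔
        a.val + b.val = 18 * q + 8 ∧ a.val < 6 * q + 3 := by
    intro a b
    constructor
    · rintro ⟨i, hi, h1, h2⟩
      rw [eq_natCast_iff_val (by omega)] at h1 h2
      omega
    · rintro ⟨h1, h2⟩
      refine ⟨a.val, by omega, ?_, ?_⟩ <;> rw [eq_natCast_iff_val (by omega)]
      omega
  have horizontal : ∀ a b : ZMod (2 * (6 * q + 1) + 2 * (6 * q + 1) + 8),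
      (∃ i : ℕ, 6 * q + 1 + 2 ≤ i ∧ i ≤ 6 * q + 1 + (6 * q + 1) + 3 ∧ a = i ∧
        b = ((2 * (6 * q + 1) + 2 * (6 * q + 1) + 8 + (6 * q + 1) + 1 - i : ℕ) :
          ZMod (2 * (6 * q + 1) + 2 * (6 * q + 1) + 8))) ↔
        a.val + b.val = 30 * q + 14 ∧ 6 * q + 3 ≤ a.val ∧ a.val < 12 * q + 6 := by
    intro a b
    constructor
    · rintro ⟨i, hi, hi', h1, h2⟩
      rw [eq_natCast_iff_val (by omega)] at h1 h2
      omega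
    · rintro ⟨h1, h2, h3⟩
      refine ⟨a.val, by omega, by omega, ?_, ?_⟩ <;> rw [eq_natCast_iff_val (by omega)]
      omega
  rw [ECG, SimpleGraph.fromRel_adj, vertical, vertical, horizontal, horizontal,
    eq_add_one_iff_val, eq_add_one_iff_val, Ne, ← (ZMod.val_injective _).eq_iff]
  omega

/-! ### A zero forcing set -/

/-- The labels of four vertices forming a zero forcing set. -/
def forcingLabel (q : ℕ) : Fin 4 → ℕ := ![0, 18 * q + 8, 18 * q + 9, 24 * q + 11]

theorem forcingLabel_lt (q : ℕ) (i : Fin 4) : forcingLabel q i < 24 * q + 12 := by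
  fin_cases i <;> simp [forcingLabel] <;> omega

theorem forcingVertex_injective (q : ℕ) :
    Function.Injective fun i => ecgVertex q (forcingLabel q i) := by
  intro i j h
  have hij : forcingLabel q i = forcingLabel q j := by
    rw [← val_ecgVertex (forcingLabel_lt q i), ← val_ecgVertex (forcingLabel_lt q j)]
    exact congrArg ZMod.val h
  fin_cases i <;> fin_cases j <;> simp [forcingLabel] at hij ⊢ <;> omega

theorem isZeroForcingSet_ecg (q : ℕ) :
    IsZeroForcingSet (ECG (6 * q + 1) (6 * q + 1))
      (Set.range fun i => ecgVertex q (forcingLabel q i)) := by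
  set Z := Set.range fun i => ecgVertex q (forcingLabel q i)
  let P : ℕ → Prop := fun m => Forced (ECG (6 * q + 1) (6 * q + 1)) Z (ecgVertex q m)
  have init : ∀ i, P (forcingLabel q i) := fun i => Forced.init _ ⟨i, rfl⟩
  have h0 : P 0 := init 0
  have h1 : P (18 * q + 8) := init 1
  have h2 : P (18 * q + 9) := init 2
  have h3 : P (24 * q + 11) := init 3
  have force : ∀ u w, u < 24 * q + 12 → w < 24 * q + 12 → P u →
      (ECG (6 * q + 1) (6 * q + 1)).Adj (ecgVertex q u) (ecgVertex q w) →
      (∀ x < 24 * q + 12, (ECG (6 * q + 1) (6 * q + 1)).Adj (ecgVertex q u) (ecgVertex q x) →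
        x ≠ w → P x) → P w := by
    intro u w _ _ hPu huw hx
    refine Forced.force _ _ hPu huw fun x hux hxw => ?_
    have hxv : ecgVertex q x.val = x := ZMod.natCast_zmod_val x
    rw [← hxv] at hux hxw ⊢
    refine hx _ (lt_of_lt_of_eq (ZMod.val_lt x) (by ring)) hux ?_
    rintro rfl
    exact hxw rfl
  have ladderAC : ∀ i ≤ 6 * q + 2, ∀ j ≤ i, P j ∧ P (18 * q + 8 - j) := by
    intro i
    induction i with
    | zero =>
      intro _ j hj
      obtain rfl : j = 0 := by omega
      exact ⟨h0, h1⟩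
    | succ i ih =>
      intro hi j hj
      have ih := ih (by omega)
      rcases Nat.lt_or_ge i j with hij | hij
      · obtain rfl : j = i + 1 := by omega
        constructor
        · refine force i _ (by omega) (by omega) (ih i le_rfl).1 ?_ fun x hx hadj hne => ?_
          · rw [ecg_adj_iff_val, val_ecgVertex (by omega), val_ecgVertex (by omega)]
            omega
          · rw [ecg_adj_iff_val, val_ecgVertex hx, val_ecgVertex (by omega)] at hadj
            have : x = 24 * q + 11 ∨ x = 18 * q + 8 - i ∨ x ≤ i := by omega
            rcases this with rfl | rfl | h
            exacts [h3, (ih i le_rfl).2, (ih x h).1]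
        · refine force (18 * q + 8 - i) _ (by omega) (by omega) (ih i le_rfl).2 ?_
            fun x hx hadj hne => ?_
          · rw [ecg_adj_iff_val, val_ecgVertex (by omega), val_ecgVertex (by omega)]
            omega
          · rw [ecg_adj_iff_val, val_ecgVertex hx, val_ecgVertex (by omega)] at hadj
            have : x = 18 * q + 9 ∨ x = i ∨ (18 * q + 8 - x ≤ i ∧ x ≤ 18 * q + 8) := by omega
            rcases this with rfl | rfl | ⟨h, h'⟩
            · exact h2
            · exact (ih x le_rfl).1
            · have := (ih _ h).2
              rwa [Nat.sub_sub_self h'] at this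
      · exact ih j hij
  have hA : ∀ m < 6 * q + 3, P m := fun m hm => (ladderAC m (by omega) m le_rfl).1
  have hC : ∀ m, 12 * q + 6 ≤ m → m < 18 * q + 9 → P m := fun m hm hm' => by
    have := (ladderAC (18 * q + 8 - m) (by omega) _ le_rfl).2
    rwa [Nat.sub_sub_self (by omega)] at this
  have hb0 : P (6 * q + 3) := by
    refine force (6 * q + 2) _ (by omega) (by omega) (hA _ (by omega)) ?_ fun x hx hadj hne => ?_
    · rw [ecg_adj_iff_val, val_ecgVertex (by omega), val_ecgVertex (by omega)]
      omega
    · rw [ecg_adj_iff_val, val_ecgVertex hx, val_ecgVertex (by omega)] at hadj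
      have : x < 6 * q + 3 ∨ (12 * q + 6 ≤ x ∧ x < 18 * q + 9) ∨ x = 24 * q + 11 := by omega
      rcases this with h | ⟨h, h'⟩ | rfl
      exacts [hA x h, hC x h h', h3]
  have hb1 : P (12 * q + 5) := by
    refine force (12 * q + 6) _ (by omega) (by omega) (hC _ (by omega) (by omega)) ?_
      fun x hx hadj hne => ?_
    · rw [ecg_adj_iff_val, val_ecgVertex (by omega), val_ecgVertex (by omega)]
      omega
    · rw [ecg_adj_iff_val, val_ecgVertex hx, val_ecgVertex (by omega)] at hadj
      have : x < 6 * q + 3 ∨ (12 * q + 6 ≤ x ∧ x < 18 * q + 9) := by omega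
      rcases this with h | ⟨h, h'⟩
      exacts [hA x h, hC x h h']
  have ladderBD : ∀ i ≤ 6 * q + 2, ∀ j ≤ i, P (6 * q + 3 + j) ∧ P (24 * q + 11 - j) := by
    intro i
    induction i with
    | zero =>
      intro _ j hj
      obtain rfl : j = 0 := by omega
      exact ⟨hb0, h3⟩
    | succ i ih =>
      intro hi j hj
      have ih := ih (by omega)
      rcases Nat.lt_or_ge i j with hij | hij
      · obtain rfl : j = i + 1 := by omega
        constructor
        · refine force (6 * q + 3 + i) _ (by omega) (by omega) (ih i le_rfl).1 ?_
            fun x hx hadj hne => ?_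
          · rw [ecg_adj_iff_val, val_ecgVertex (by omega), val_ecgVertex (by omega)]
            omega
          · rw [ecg_adj_iff_val, val_ecgVertex hx, val_ecgVertex (by omega)] at hadj
            have : x < 6 * q + 3 ∨ x = 24 * q + 11 - i ∨
              (x - (6 * q + 3) ≤ i ∧ 6 * q + 3 ≤ x) := by omega
            rcases this with h | rfl | ⟨h, h'⟩
            · exact hA x h
            · exact (ih i le_rfl).2
            · have := (ih _ h).1
              rwa [Nat.add_sub_cancel' h'] at this
        · refine force (24 * q + 11 - i) _ (by omega) (by omega) (ih i le_rfl).2 ?_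
            fun x hx hadj hne => ?_
          · rw [ecg_adj_iff_val, val_ecgVertex (by omega), val_ecgVertex (by omega)]
            omega
          · rw [ecg_adj_iff_val, val_ecgVertex hx, val_ecgVertex (by omega)] at hadj
            have : x = 0 ∨ x = 6 * q + 3 + i ∨
              (24 * q + 11 - x ≤ i ∧ x ≤ 24 * q + 11) := by omega
            rcases this with rfl | rfl | ⟨h, h'⟩
            · exact h0
            · exact (ih i le_rfl).1
            · have := (ih _ h).2
              rwa [Nat.sub_sub_self h'] at this
      · exact ih j hij
  intro v
  have hv := ZMod.val_lt v
  have hvv : ecgVertex q v.val = v := ZMod.natCast_zmod_val v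
  rw [← hvv]
  change P v.val
  generalize v.val = m at hv
  have : m < 6 * q + 3 ∨ (m - (6 * q + 3) ≤ 6 * q + 2 ∧ 6 * q + 3 ≤ m) ∨
    (12 * q + 6 ≤ m ∧ m < 18 * q + 9) ∨ (24 * q + 11 - m ≤ 6 * q + 2 ∧ m ≤ 24 * q + 11) := by
    omega
  rcases this with h | ⟨h, h'⟩ | ⟨h, h'⟩ | ⟨h, h'⟩
  · exact hA m h
  · have := (ladderBD _ h _ le_rfl).1
    rwa [Nat.add_sub_cancel' h'] at this
  · exact hC m h h'
  · have := (ladderBD _ h _ le_rfl).2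
    rwa [Nat.sub_sub_self h'] at this

/-! ### Null vectors of the adjacency matrix -/

theorem adjMat_mulVec_eq_zero {F : Type*} [Field F] (q : ℕ) (X : ℕ → F)
    (h : ∀ m l r p, m < 24 * q + 12 → l < 24 * q + 12 → r < 24 * q + 12 → p < 24 * q + 12 →
      (l + 1 = m ∨ m = 0 ∧ l = 24 * q + 11) → (r = m + 1 ∨ m = 24 * q + 11 ∧ r = 0) →
      (m + p = 18 * q + 8 ∧ (m < 6 * q + 3 ∨ p < 6 * q + 3) ∨
        m + p = 30 * q + 14 ∧ (6 * q + 3 ≤ m ∧ m < 12 * q + 6 ∨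
          6 * q + 3 ≤ p ∧ p < 12 * q + 6)) → X l + X r + X p = 0) :
    (adjMat F (ECG (6 * q + 1) (6 * q + 1))).mulVec (fun a => X a.val) = 0 := by
  ext a
  have ha := ZMod.val_lt a
  obtain ⟨l, hl, hl'⟩ : ∃ l < 24 * q + 12,
      (l + 1 = a.val ∨ a.val = 0 ∧ l = 24 * q + 11) := by
    by_cases h0 : a.val = 0
    · exact ⟨24 * q + 11, by omega, by omega⟩
    · exact ⟨a.val - 1, by omega, by omega⟩
  obtain ⟨r, hr, hr'⟩ : ∃ r < 24 * q + 12,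
      (r = a.val + 1 ∨ a.val = 24 * q + 11 ∧ r = 0) := by
    by_cases h0 : a.val = 24 * q + 11
    · exact ⟨0, by omega, by omega⟩
    · exact ⟨a.val + 1, by omega, by omega⟩
  obtain ⟨p, hp, hp'⟩ : ∃ p < 24 * q + 12,
      (a.val + p = 18 * q + 8 ∧ (a.val < 6 * q + 3 ∨ p < 6 * q + 3) ∨
        a.val + p = 30 * q + 14 ∧ (6 * q + 3 ≤ a.val ∧ a.val < 12 * q + 6 ∨
          6 * q + 3 ≤ p ∧ p < 12 * q + 6)) := by
    by_cases h0 : a.val < 6 * q + 3 ∨ 12 * q + 6 ≤ a.val ∧ a.val < 18 * q + 9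
    · exact ⟨18 * q + 8 - a.val, by omega, by omega⟩
    · exact ⟨30 * q + 14 - a.val, by omega, by omega⟩
  have hnbr : Finset.univ.filter ((ECG (6 * q + 1) (6 * q + 1)).Adj a) =
      {ecgVertex q l, ecgVertex q r, ecgVertex q p} := by
    ext b
    have hb := ZMod.val_lt b
    simp only [Finset.mem_filter, Finset.mem_univ, true_and, Finset.mem_insert,
      Finset.mem_singleton, ecg_adj_iff_val]
    rw [eq_natCast_iff_val (by omega), eq_natCast_iff_val (by omega),
      eq_natCast_iff_val (by omega)]
    omega
  have hlr : ecgVertex q l ∉ ({ecgVertex q r, ecgVertex q p} : Finset _) := by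
    simp only [Finset.mem_insert, Finset.mem_singleton]
    rw [eq_natCast_iff_val (by omega), eq_natCast_iff_val (by omega), val_ecgVertex hl]
    omega
  have hrp : ecgVertex q r ∉ ({ecgVertex q p} : Finset _) := by
    rw [Finset.mem_singleton, eq_natCast_iff_val (by omega), val_ecgVertex hr]
    omega
  have hsum := h a.val l r p (by omega) hl hr hp hl' hr' hp'
  simp only [Matrix.mulVec, dotProduct, adjMat, Matrix.of_apply, ite_mul, one_mul, zero_mul,
    Pi.zero_apply]
  rw [← Finset.sum_filter, hnbr, Finset.sum_insert hlr, Finset.sum_insert hrp,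
    Finset.sum_singleton, val_ecgVertex hl, val_ecgVertex hr, val_ecgVertex hp, ← hsum, add_assoc]

/-- The `6`-periodic values of a null vector along one side of a ladder. -/
def ladderVec {F : Type*} [Field F] (a b c d : F) (m : ℕ) : F :=
  match m % 6 with
  | 0 => a
  | 1 => -d - b
  | 2 => c
  | 3 => b
  | 4 => -c - a
  | _ => d

theorem ladderVec_swap_outer {F : Type*} [Field F] (a b c d : F) {m : ℕ}
    (hm : m % 6 = 2 ∨ m % 6 = 3) : ladderVec a b c d m = ladderVec d b c a m := by
  rcases hm with hm | hm <;> simp [ladderVec, hm]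

theorem ladderVec_swap_inner {F : Type*} [Field F] (a b c d : F) {m : ℕ}
    (hm : m % 6 = 0 ∨ m % 6 = 5) : ladderVec a b c d m = ladderVec a c b d m := by
  rcases hm with hm | hm <;> simp [ladderVec, hm]

theorem ladderVec_sum {F : Type*} [Field F] (a b c d : F) {m l r p : ℕ}
    (hl : (l + 1) % 6 = m % 6) (hr : r % 6 = (m + 1) % 6) (hp : (m + p) % 6 = 2) :
    ladderVec a b c d l + ladderVec a b c d r + ladderVec d c b a p = 0 := by
  have hl' : l % 6 = (m % 6 + 5) % 6 := by omega
  have hr' : r % 6 = (m % 6 + 1) % 6 := by omega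
  have hp' : p % 6 = (8 - m % 6) % 6 := by omega
  have hm := Nat.mod_lt m (show 0 < 6 by decide)
  rw [ladderVec, ladderVec, ladderVec, hl', hr', hp']
  interval_cases m % 6 <;> simp only [Nat.reduceAdd, Nat.reduceSub, Nat.reduceMod] <;> ring

/-- The null vector with prescribed values on the zero forcing set, given separately on the
four blocks of `6q+3` consecutive vertices. -/
def nullVec {F : Type*} [Field F] (q : ℕ) (c : Fin 4 → F) (m : ℕ) : F :=
  if m < 6 * q + 3 then ladderVec (c 0) (c 1) (c 2) (c 3) m
  else if m < 12 * q + 6 then ladderVec (c 3) (c 1) (c 2) (c 0) m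
  else if m < 18 * q + 9 then ladderVec (c 3) (c 2) (c 1) (c 0) m
  else ladderVec (c 0) (c 2) (c 1) (c 3) m

section NullVec

variable {F : Type*} [Field F] (q : ℕ) (c : Fin 4 → F)

theorem nullVec_eq_block_zero {m : ℕ} (hm : m ≤ 6 * q + 3 ∨ m = 24 * q + 11) :
    nullVec q c m = ladderVec (c 0) (c 1) (c 2) (c 3) m := by
  rw [nullVec]
  split_ifs
  · rfl
  · exact ladderVec_swap_outer _ _ _ _ (by omega)
  · omega
  · exact ladderVec_swap_inner _ _ _ _ (by omega)

theorem nullVec_eq_block_one {m : ℕ} (hm : 6 * q + 2 ≤ m) (hm' : m ≤ 12 * q + 6) :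
    nullVec q c m = ladderVec (c 3) (c 1) (c 2) (c 0) m := by
  rw [nullVec]
  split_ifs
  · exact ladderVec_swap_outer _ _ _ _ (by omega)
  · rfl
  · exact ladderVec_swap_inner _ _ _ _ (by omega)
  · omega

theorem nullVec_eq_block_two {m : ℕ} (hm : 12 * q + 5 ≤ m) (hm' : m ≤ 18 * q + 9) :
    nullVec q c m = ladderVec (c 3) (c 2) (c 1) (c 0) m := by
  rw [nullVec]
  split_ifs
  · omega
  · exact ladderVec_swap_inner _ _ _ _ (by omega)
  · rfl
  · exact ladderVec_swap_outer _ _ _ _ (by omega)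

theorem nullVec_eq_block_three {m : ℕ} (hm : 18 * q + 8 ≤ m ∨ m = 0) :
    nullVec q c m = ladderVec (c 0) (c 2) (c 1) (c 3) m := by
  rw [nullVec]
  split_ifs
  · exact ladderVec_swap_inner _ _ _ _ (by omega)
  · omega
  · exact ladderVec_swap_outer _ _ _ _ (by omega)
  · rfl

theorem nullVec_forcingLabel (i : Fin 4) : nullVec q c (forcingLabel q i) = c i := by
  fin_cases i
  · simp [forcingLabel, nullVec, ladderVec]
  · change nullVec q c (18 * q + 8) = c 1
    rw [nullVec_eq_block_two q c (by omega) (by omega), ladderVec]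
    simp [show (18 * q + 8) % 6 = 2 by omega]
  · change nullVec q c (18 * q + 9) = c 2
    rw [nullVec_eq_block_three q c (by omega), ladderVec]
    simp [show (18 * q + 9) % 6 = 3 by omega]
  · change nullVec q c (24 * q + 11) = c 3
    rw [nullVec_eq_block_three q c (by omega), ladderVec]
    simp [show (24 * q + 11) % 6 = 5 by omega]

theorem nullVec_sum_neighbors (m l r p : ℕ)
    (hm : m < 24 * q + 12) (hl : l < 24 * q + 12) (hr : r < 24 * q + 12) (hp : p < 24 * q + 12)
    (hml : l + 1 = m ∨ m = 0 ∧ l = 24 * q + 11) (hmr : r = m + 1 ∨ m = 24 * q + 11 ∧ r = 0)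
    (hmp : m + p = 18 * q + 8 ∧ (m < 6 * q + 3 ∨ p < 6 * q + 3) ∨
        m + p = 30 * q + 14 ∧ (6 * q + 3 ≤ m ∧ m < 12 * q + 6 ∨
          6 * q + 3 ≤ p ∧ p < 12 * q + 6)) :
    nullVec q c l + nullVec q c r + nullVec q c p = 0 := by
  have : m < 6 * q + 3 ∨ (6 * q + 3 ≤ m ∧ m < 12 * q + 6) ∨
      (12 * q + 6 ≤ m ∧ m < 18 * q + 9) ∨ 18 * q + 9 ≤ m := by omega
  have hl6 : (l + 1) % 6 = m % 6 := by omega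
  have hr6 : r % 6 = (m + 1) % 6 := by omega
  have hp6 : (m + p) % 6 = 2 := by omega
  rcases this with h | h | h | h
  · rw [nullVec_eq_block_zero q c (m := l) (by omega),
      nullVec_eq_block_zero q c (m := r) (by omega),
      nullVec_eq_block_two q c (m := p) (by omega) (by omega)]
    exact ladderVec_sum _ _ _ _ hl6 hr6 hp6
  · rw [nullVec_eq_block_one q c (m := l) (by omega) (by omega),
      nullVec_eq_block_one q c (m := r) (by omega) (by omega),
      nullVec_eq_block_three q c (m := p) (by omega)]
    exact ladderVec_sum _ _ _ _ hl6 hr6 hp6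
  · rw [nullVec_eq_block_two q c (m := l) (by omega) (by omega),
      nullVec_eq_block_two q c (m := r) (by omega) (by omega),
      nullVec_eq_block_zero q c (m := p) (by omega)]
    exact ladderVec_sum _ _ _ _ hl6 hr6 hp6
  · rw [nullVec_eq_block_three q c (m := l) (by omega),
      nullVec_eq_block_three q c (m := r) (by omega),
      nullVec_eq_block_one q c (m := p) (by omega) (by omega)]
    exact ladderVec_sum _ _ _ _ hl6 hr6 hp6

end NullVec

theorem stmt19 (q : ℕ) :
    ∀ (F : Type) [Field F],
      (adjMat F (ECG (6 * q + 1) (6 * q + 1))).rank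
          = Fintype.card (ZMod (2 * (6 * q + 1) + 2 * (6 * q + 1) + 8)) - 4 ∧
      minRank F (ECG (6 * q + 1) (6 * q + 1))
          = (adjMat F (ECG (6 * q + 1) (6 * q + 1))).rank ∧
      maxNullity F (ECG (6 * q + 1) (6 * q + 1)) = zfn (ECG (6 * q + 1) (6 * q + 1)) ∧
      zfn (ECG (6 * q + 1) (6 * q + 1)) = 4 := by
  intro F _
  have hcard : (Set.range fun i => ecgVertex q (forcingLabel q i)).ncard = 4 := by
    rw [← Set.image_univ, Set.ncard_image_of_injective _ (forcingVertex_injective q),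
      Set.ncard_univ, Nat.card_fin]
  have hrank := rank_add_card_le_of_forall_extend (adjMat F (ECG (6 * q + 1) (6 * q + 1)))
    (fun i => ecgVertex q (forcingLabel q i)) fun c =>
      ⟨fun a => nullVec q c a.val, adjMat_mulVec_eq_zero q _ (nullVec_sum_neighbors q c),
        fun i => by
          simp only [val_ecgVertex (forcingLabel_lt q i), nullVec_forcingLabel]⟩
  rw [Fintype.card_fin, ← hcard] at hrank
  have := adjMat_optimal (isZeroForcingSet_ecg q) hrank
  rwa [hcard] at this

end Paper
end
end
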